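/- Let k be a field, G a group, and V a finite-dimensional k-vector space of dimension n on which G acts linearly and irreducibly. Let G' be a normal subgroup of G of finite index, and suppose that as a representation of G' the space V decomposes as a direct sum of m > 1 pairwise non-isomorphic irreducible G'-subrepresentations W_1, ..., W_m. Then m divides n, all the W_k have the same dimension n/m, and there exist a proper subgroup H of G with G' ≤ H ≤ G and [G : H] = m, and an irreducible representation W of H, such that V is isomorphic as a G-representation to the induced representation Ind_H^G W. -/

import Mathlib

section InducedRep

variable {k G : Type} [Field k] [Group G]

/-- The underlying space of the representation of `G` induced from a representation
`σ` of a subgroup `H`, realized as the space of functions `f : G → W` satisfying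
`f (g * h) = σ h⁻¹ (f g)` for all `g ∈ G`, `h ∈ H` (for `H` of finite index this is
the usual induced module `k[G] ⊗_{k[H]} W`). -/
def IndCarrier (H : Subgroup G) {W : Type} [AddCommGroup W] [Module k W]
    (σ : Representation k ↥H W) : Submodule k (G → W) where
  carrier := {f | ∀ (g : G) (h : ↥H), f (g * ↑h) = σ h⁻¹ (f g)}
  add_mem' := fun {a b} ha hb => by
    intro g h
    simp only [Pi.add_apply, ha g h, hb g h, map_add]
  zero_mem' := by
    intro g h
    simp only [Pi.zero_apply, map_zero]
  smul_mem' := fun c f hf => by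
    intro g h
    simp only [Pi.smul_apply, hf g h, map_smul]

/-- Left translation by `g₀` on the space of functions `G → W`. -/
def translateAux (g₀ : G) (W : Type) [AddCommGroup W] [Module k W] :
    (G → W) →ₗ[k] (G → W) where
  toFun f := fun x => f (g₀⁻¹ * x)
  map_add' := fun _ _ => rfl
  map_smul' := fun _ _ => rfl

/-- The representation of `G` induced from the representation `σ` of the subgroup `H`:
`G` acts on `IndCarrier H σ` by left translation. -/
def indRep (H : Subgroup G) {W : Type} [AddCommGroup W] [Module k W]
    (σ : Representation k ↥H W) : Representation k G (IndCarrier H σ) where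
  toFun g₀ := (translateAux g₀ W).restrict (p := IndCarrier H σ) (q := IndCarrier H σ)
    (fun f hf => by
      intro g h
      simpa [translateAux, mul_assoc] using hf (g₀⁻¹ * g) h)
  map_one' := by
    apply LinearMap.ext; intro f; apply Subtype.ext; funext x
    simp [translateAux, LinearMap.restrict_apply]
  map_mul' g₁ g₂ := by
    apply LinearMap.ext; intro f; apply Subtype.ext; funext x
    simp [translateAux, LinearMap.restrict_apply, mul_assoc]

/-- A representation of a group `H` over `k`, bundled with its underlying space. -/
structure RepOn (k H : Type) [Field k] [Group H] where
  /-- the underlying vector space -/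
  carrier : Type
  [acg : AddCommGroup carrier]
  [mod : Module k carrier]
  /-- the representation -/
  rep : Representation k H carrier

attribute [instance] RepOn.acg RepOn.mod

end InducedRep

section Decomposition

variable {k V ι : Type*} [Field k] [AddCommGroup V] [Module k V] [DecidableEq ι]
  {W : ι → Submodule k V}

/-- The projection onto a summand of an internal direct sum decomposition. -/
noncomputable def DirectSum.IsInternal.proj (h : DirectSum.IsInternal W) (i : ι) :
    V →ₗ[k] W i :=
  DirectSum.component k ι (fun i => W i) i ∘ₗ
    (LinearEquiv.ofBijective (DirectSum.coeLinearMap W) h).symm.toLinearMap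

theorem DirectSum.IsInternal.proj_of_mem (h : DirectSum.IsInternal W) {i : ι} {v : V}
    (hv : v ∈ W i) : h.proj i v = ⟨v, hv⟩ :=
  h.ofBijective_coeLinearMap_of_mem hv

theorem DirectSum.IsInternal.proj_of_mem_ne (h : DirectSum.IsInternal W) {i j : ι}
    (hij : i ≠ j) {v : V} (hv : v ∈ W i) : h.proj j v = 0 :=
  h.ofBijective_coeLinearMap_of_mem_ne hij hv

theorem DirectSum.IsInternal.eq_zero_of_proj (h : DirectSum.IsInternal W) {v : V}
    (hv : ∀ i, h.proj i v = 0) : v = 0 :=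
  (LinearEquiv.ofBijective (DirectSum.coeLinearMap W) h).symm.map_eq_zero_iff.1
    (DFinsupp.ext hv)

/-- If a linear map sends summands into summands along an injective map `τ` of indices, it
intertwines the corresponding projections. -/
theorem DirectSum.IsInternal.proj_map (h : DirectSum.IsInternal W) {τ : ι → ι}
    (hτ : Function.Injective τ) (T : V →ₗ[k] V) (hT : ∀ i, ∀ v ∈ W i, T v ∈ W (τ i))
    (i : ι) (v : V) : (h.proj (τ i) (T v) : V) = T (h.proj i v) := by
  have hv : v ∈ iSup W := h.submodule_iSup_eq_top ▸ Submodule.mem_top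
  induction hv using Submodule.iSup_induction' with
  | mem j x hx =>
    by_cases hji : j = i
    · subst hji
      rw [h.proj_of_mem hx, h.proj_of_mem (hT j x hx)]
    · rw [h.proj_of_mem_ne hji hx, h.proj_of_mem_ne (hτ.ne hji) (hT j x hx)]
      simp
  | zero => simp
  | add x y _ _ hx hy => simp only [map_add, Submodule.coe_add, hx, hy]

/-- The summands of an internal decomposition into nonzero submodules are distinct. -/
theorem DirectSum.IsInternal.injective_of_ne_bot (h : DirectSum.IsInternal W)
    (hne : ∀ i, W i ≠ ⊥) : Function.Injective W :=
  h.submodule_iSupIndep.injective hne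

end Decomposition

section Clifford

variable {k G V ι : Type*} [Field k] [Group G] [AddCommGroup V] [Module k V]
  [DecidableEq ι] {W : ι → Submodule k V} {ρ : Representation k G V} {N : Subgroup G}

/-- In a multiplicity-free decomposition into irreducible subrepresentations, the summands are
the only irreducible subrepresentations. -/
theorem exists_eq_of_irreducible_of_multiplicity_free
    (hinv : ∀ i (g : N), ∀ v ∈ W i, ρ g v ∈ W i)
    (hirr : ∀ i, ∀ q ≤ W i, (∀ g : N, ∀ v ∈ q, ρ g v ∈ q) → q = ⊥ ∨ q = W i)
    (hint : DirectSum.IsInternal W)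
    (hnoniso : ∀ i j, i ≠ j → ¬ ∃ e : W i ≃ₗ[k] W j,
      ∀ (g : N) (v : V) (hv : v ∈ W i) (hv' : ρ g v ∈ W i),
        ((e ⟨ρ g v, hv'⟩ : W j) : V) = ρ g ((e ⟨v, hv⟩ : W j) : V))
    {U : Submodule k V} (hU : ∀ g : N, ∀ v ∈ U, ρ g v ∈ U) (hUne : U ≠ ⊥)
    (hUirr : ∀ q ≤ U, (∀ g : N, ∀ v ∈ q, ρ g v ∈ q) → q = ⊥ ∨ q = U) :
    ∃ i, U = W i := by
  have hcomm (i : ι) (g : N) (v : V) : (hint.proj i (ρ g v) : V) = ρ g (hint.proj i v) :=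
    hint.proj_map Function.injective_id (ρ g) (fun j => hinv j g) i v
  have hequiv (i : ι) (hi : ∃ u ∈ U, hint.proj i u ≠ 0) :
      Function.Bijective ((hint.proj i).domRestrict U) := by
    obtain ⟨u, huU, hu⟩ := hi
    constructor
    · rw [← LinearMap.ker_eq_bot, LinearMap.ker_eq_bot']
      intro x hx
      have hker := hUirr (U ⊓ LinearMap.ker (hint.proj i)) inf_le_left (by
        rintro g v ⟨hvU, hv⟩
        refine ⟨hU g v hvU, ?_⟩
        have hv0 : hint.proj i v = 0 := hv
        have := hcomm i g v
        rw [hv0, ZeroMemClass.coe_zero, map_zero] at this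
        exact Subtype.ext this)
      rcases hker with hker | hker
      · have hmem : (x : V) ∈ U ⊓ LinearMap.ker (hint.proj i) := ⟨x.2, hx⟩
        rw [hker] at hmem
        exact Subtype.ext hmem
      · exact absurd (hker.ge huU).2 hu
    · have him := hirr i (U.map ((W i).subtype ∘ₗ hint.proj i)) (by
        rintro _ ⟨v, -, rfl⟩
        exact (hint.proj i v).2) (by
        rintro g _ ⟨v, hv, rfl⟩
        exact ⟨ρ g v, hU g v hv, hcomm i g v⟩)
      rcases him with him | him
      · have hmem : (hint.proj i u : V) ∈ U.map ((W i).subtype ∘ₗ hint.proj i) :=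
          ⟨u, huU, rfl⟩
        rw [him] at hmem
        exact absurd (Subtype.ext ((Submodule.mem_bot k).1 hmem)) hu
      · intro w
        obtain ⟨v, hv, hvw⟩ := him.ge w.2
        exact ⟨⟨v, hv⟩, Subtype.ext hvw⟩
  obtain ⟨u, huU, hu⟩ := U.ne_bot_iff.1 hUne
  obtain ⟨i, hi⟩ : ∃ i, hint.proj i u ≠ 0 := by
    by_contra! hall
    exact hu (hint.eq_zero_of_proj hall)
  have huniq (j : ι) (hji : j ≠ i) (v : V) (hv : v ∈ U) : hint.proj j v = 0 := by
    by_contra hne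
    let ei := LinearEquiv.ofBijective _ (hequiv i ⟨u, huU, hi⟩)
    let ej := LinearEquiv.ofBijective _ (hequiv j ⟨v, hv, hne⟩)
    refine hnoniso i j hji.symm ⟨ei.symm.trans ej, fun g w hw hw' => ?_⟩
    obtain ⟨x, hx⟩ := ei.surjective ⟨w, hw⟩
    have hgx : ei ⟨ρ g x, hU g x x.2⟩ = ⟨ρ g w, hw'⟩ :=
      Subtype.ext ((hcomm i g x).trans (congrArg (ρ g) (congrArg Subtype.val hx)))
    rw [← hgx, ← hx, LinearEquiv.trans_apply, LinearEquiv.trans_apply,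
      LinearEquiv.symm_apply_apply, LinearEquiv.symm_apply_apply]
    exact hcomm j g x
  have hle : U ≤ W i := by
    intro v hv
    have hv0 : v - hint.proj i v = 0 := by
      refine hint.eq_zero_of_proj fun j => ?_
      by_cases hji : j = i
      · subst hji
        rw [map_sub, hint.proj_of_mem (hint.proj j v).2, Subtype.coe_eta, sub_self]
      · rw [map_sub, huniq j hji v hv, hint.proj_of_mem_ne (Ne.symm hji) (hint.proj i v).2,
          sub_zero]
    rw [sub_eq_zero.1 hv0]
    exact (hint.proj i v).2
  exact ⟨i, (hirr i U hle hU).resolve_left hUne⟩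

/-- A group permutes the summands of a multiplicity-free decomposition over a normal
subgroup. -/
theorem exists_mulAction_of_multiplicity_free [N.Normal]
    (hinv : ∀ i (g : N), ∀ v ∈ W i, ρ g v ∈ W i)
    (hne : ∀ i, W i ≠ ⊥)
    (hirr : ∀ i, ∀ q ≤ W i, (∀ g : N, ∀ v ∈ q, ρ g v ∈ q) → q = ⊥ ∨ q = W i)
    (hint : DirectSum.IsInternal W)
    (hnoniso : ∀ i j, i ≠ j → ¬ ∃ e : W i ≃ₗ[k] W j,
      ∀ (g : N) (v : V) (hv : v ∈ W i) (hv' : ρ g v ∈ W i),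
        ((e ⟨ρ g v, hv'⟩ : W j) : V) = ρ g ((e ⟨v, hv⟩ : W j) : V)) :
    ∃ _ : MulAction G ι, ∀ (g : G) (i : ι), (W i).map (ρ g) = W (g • i) := by
  have hmap (g : G) (i : ι) {q : Submodule k V} (hq : ∀ x : N, ∀ v ∈ q, ρ x v ∈ q) (x : N) :
      ∀ v ∈ q.map (ρ g), ρ x v ∈ q.map (ρ g) := by
    rintro _ ⟨v, hv, rfl⟩
    have hmem : g⁻¹ * x * g ∈ N := by
      simpa using Subgroup.Normal.conj_mem ‹N.Normal› x x.2 g⁻¹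
    refine ⟨ρ (g⁻¹ * x * g) v, hq ⟨_, hmem⟩ v hv, ?_⟩
    rw [← Module.End.mul_apply, ← Module.End.mul_apply, ← map_mul, ← map_mul]
    congr 2
    group
  have hcancel (g : G) (q : Submodule k V) : (q.map (ρ g⁻¹)).map (ρ g) = q := by
    rw [← Submodule.map_comp, ← Module.End.mul_eq_comp, ← map_mul, mul_inv_cancel, map_one,
      Module.End.one_eq_id, Submodule.map_id]
  have hcancel' (g : G) (q : Submodule k V) : (q.map (ρ g)).map (ρ g⁻¹) = q := by
    simpa using hcancel g⁻¹ q
  have hex (g : G) (i : ι) : ∃ j, (W i).map (ρ g) = W j := by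
    refine exists_eq_of_irreducible_of_multiplicity_free hinv hirr hint hnoniso
      (hmap g i (hinv i)) (fun h => hne i ?_) fun q hq hqinv => ?_
    · rw [← hcancel' g (W i), h, Submodule.map_bot]
    · have hle : q.map (ρ g⁻¹) ≤ W i := by
        rw [← hcancel' g (W i)]
        exact Submodule.map_mono hq
      rcases hirr i _ hle (hmap g⁻¹ i hqinv) with h | h
      · left
        rw [← hcancel g q, h, Submodule.map_bot]
      · right
        rw [← hcancel g q, h]
  choose act hact using hex
  have hinj := hint.injective_of_ne_bot hne
  refine ⟨{ smul := act, one_smul := fun i => hinj ?_, mul_smul := fun g h i => hinj ?_ }, hact⟩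
  · refine (hact (g * h) i).symm.trans (Eq.trans ?_ (hact g (act h i)))
    rw [map_mul, Module.End.mul_eq_comp, Submodule.map_comp, hact h i]
  · refine (hact 1 i).symm.trans ?_
    rw [map_one, Module.End.one_eq_id, Submodule.map_id]

end Clifford

section Imprimitivity

variable {k G V ι : Type} [Field k] [Group G] [AddCommGroup V] [Module k V]
  [MulAction G ι] {W : ι → Submodule k V}

/-- The representation of the stabilizer of an index on the corresponding summand of a
decomposition permuted by the group. -/
def stabilizerRep (ρ : Representation k G V)
    (hρ : ∀ (g : G) (i : ι), ∀ v ∈ W i, ρ g v ∈ W (g • i)) (i : ι) :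
    Representation k (MulAction.stabilizer G i) (W i) where
  toFun h := (ρ h).restrict fun v hv => by
    have hmem := hρ h i v hv
    rwa [show (h : G) • i = i from h.2] at hmem
  map_one' := by
    ext v
    simp [LinearMap.restrict_apply]
  map_mul' g h := by
    ext v
    simp [LinearMap.restrict_apply]

variable {ρ : Representation k G V}
  (hρ : ∀ (g : G) (i : ι), ∀ v ∈ W i, ρ g v ∈ W (g • i))

@[simp]
theorem coe_stabilizerRep_apply (i : ι) (h : MulAction.stabilizer G i) (w : W i) :
    (stabilizerRep ρ hρ i h w : V) = ρ h w :=
  rfl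

/-- A representation with a decomposition permuted transitively by the group is induced from
the stabilizer of a summand. -/
theorem exists_equiv_indRep_stabilizer [DecidableEq ι] [Fintype ι] [MulAction.IsPretransitive G ι]
    (hint : DirectSum.IsInternal W) (i : ι) :
    ∃ e : V ≃ₗ[k] IndCarrier (MulAction.stabilizer G i) (stabilizerRep ρ hρ i),
      ∀ (g : G) (v : V), e (ρ g v) = indRep _ (stabilizerRep ρ hρ i) g (e v) := by
  have hproj (g : G) (j : ι) (v : V) :
      (hint.proj (g • j) (ρ g v) : V) = ρ g (hint.proj j v) :=
    hint.proj_map (MulAction.injective g) (ρ g) (hρ g) j v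
  have hproj_eq (g : G) (v : V) :
      (hint.proj i (ρ g⁻¹ v) : V) = ρ g⁻¹ (hint.proj (g • i) v) := by
    rw [← hproj, inv_smul_smul]
  let φ : V →ₗ[k] IndCarrier (MulAction.stabilizer G i) (stabilizerRep ρ hρ i) :=
    { toFun := fun v => ⟨fun g => hint.proj i (ρ g⁻¹ v), fun g h => by
        apply Subtype.ext
        have hh : (g * (h : G)) • i = g • i := by rw [mul_smul, show (h : G) • i = i from h.2]
        rw [hproj_eq, hh, coe_stabilizerRep_apply, hproj_eq, mul_inv_rev, map_mul]
        rfl⟩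
      map_add' := fun v w => by
        apply Subtype.ext
        funext g
        simp
      map_smul' := fun c v => by
        apply Subtype.ext
        funext g
        simp }
  have hφ (v : V) (g : G) : (φ v).1 g = hint.proj i (ρ g⁻¹ v) := rfl
  have hinj : Function.Injective φ := by
    rw [← LinearMap.ker_eq_bot, LinearMap.ker_eq_bot']
    intro v hv
    refine hint.eq_zero_of_proj fun j => ?_
    obtain ⟨g, rfl⟩ := MulAction.exists_smul_eq G i j
    have h0 : ρ g⁻¹ (hint.proj (g • i) v) = 0 := by
      rw [← hproj_eq, ← hφ, hv]
      rfl
    have h1 := congrArg (ρ g) h0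
    rw [← Module.End.mul_apply, ← map_mul, mul_inv_cancel, map_one, map_zero] at h1
    exact Subtype.ext h1
  have hsurj : Function.Surjective φ := by
    intro f
    choose r hr using fun j => MulAction.exists_smul_eq G i j
    refine ⟨∑ j, ρ (r j) (f.1 (r j)), Subtype.ext (funext fun g => ?_)⟩
    have hrg : (r (g • i))⁻¹ * g ∈ MulAction.stabilizer G i := by
      rw [MulAction.mem_stabilizer_iff, mul_smul, inv_smul_eq_iff, hr]
    have hmem (j : ι) : ρ (r j) (f.1 (r j)) ∈ W j := by
      have hj := hρ (r j) i _ (f.1 (r j)).2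
      rwa [hr] at hj
    apply Subtype.ext
    rw [hφ, hproj_eq, map_sum, Finset.sum_eq_single (g • i)
      (fun j _ hj => hint.proj_of_mem_ne hj (hmem j)) (by simp), hint.proj_of_mem (hmem _)]
    have hf := f.2 (r (g • i)) ⟨_, hrg⟩
    rw [Subtype.coe_mk, mul_inv_cancel_left] at hf
    rw [hf, coe_stabilizerRep_apply, ← Module.End.mul_apply, ← map_mul]
    simp
  refine ⟨LinearEquiv.ofBijective φ ⟨hinj, hsurj⟩, fun g v => ?_⟩
  apply Subtype.ext
  funext x
  change hint.proj i (ρ x⁻¹ (ρ g v)) = hint.proj i (ρ (g⁻¹ * x)⁻¹ v)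
  rw [mul_inv_rev, inv_inv, map_mul, Module.End.mul_apply]

end Imprimitivity

/-- **Clifford theory for multiplicity-free decompositions.**
Let `V` be an irreducible `n`-dimensional representation of `G` over a field `k`, let
`G'` be a normal subgroup of finite index, and suppose that as a representation of `G'`
the space `V` decomposes as an internal direct sum of `m > 1` pairwise non-isomorphic
irreducible `G'`-subrepresentations `W 0, ..., W (m-1)`.  Then `m ∣ n`, each `W i` has
dimension `n / m`, and there are a proper subgroup `H` of `G` containing `G'` with
`[G : H] = m` and an irreducible representation `P` of `H` such that `V` is isomorphic
as a representation of `G` to the induced representation `Ind_H^G P`. -/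
theorem irreducible_induced_of_multiplicity_free_decomposition
    {k G V : Type} [Field k] [Group G] [AddCommGroup V] [Module k V]
    [FiniteDimensional k V]
    (n : ℕ) (hn : Module.finrank k V = n)
    (ρ : Representation k G V)
    (hVne : ∃ v : V, v ≠ 0)
    (hirr : ∀ p : Submodule k V, (∀ (g : G), ∀ v ∈ p, ρ g v ∈ p) → p = ⊥ ∨ p = ⊤)
    (G' : Subgroup G) [G'.Normal] (hfin : G'.FiniteIndex)
    (m : ℕ) (hm : 1 < m)
    (W : Fin m → Submodule k V)
    (hWinv : ∀ i (g : ↥G'), ∀ v ∈ W i, ρ ↑g v ∈ W i)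
    (hWne : ∀ i, W i ≠ ⊥)
    (hWirr : ∀ i, ∀ q ≤ W i, (∀ (g : ↥G'), ∀ v ∈ q, ρ ↑g v ∈ q) → q = ⊥ ∨ q = W i)
    (hWint : DirectSum.IsInternal W)
    (hWnoniso : ∀ i j, i ≠ j →
      ¬ ∃ e : W i ≃ₗ[k] W j,
        ∀ (g : ↥G') (v : V) (hv : v ∈ W i) (hv' : ρ ↑g v ∈ W i),
          ((e ⟨ρ ↑g v, hv'⟩ : W j) : V) = ρ ↑g ((e ⟨v, hv⟩ : W j) : V)) :
    m ∣ n ∧ (∀ i, Module.finrank k ↥(W i) = n / m) ∧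
    ∃ H : Subgroup G, G' ≤ H ∧ H ≠ ⊤ ∧ H.index = m ∧
      ∃ P : RepOn k ↥H,
        (∃ w : P.carrier, w ≠ 0) ∧
        (∀ q : Submodule k P.carrier,
          (∀ (h : ↥H), ∀ w ∈ q, P.rep h w ∈ q) → q = ⊥ ∨ q = ⊤) ∧
        ∃ e : V ≃ₗ[k] IndCarrier H P.rep,
          ∀ (g : G) (v : V), e (ρ g v) = indRep H P.rep g (e v) := by
  obtain ⟨hact, hmap⟩ :=
    exists_mulAction_of_multiplicity_free hWinv hWne hWirr hWint hWnoniso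
  have hρ (g : G) (i : Fin m) : ∀ v ∈ W i, ρ g v ∈ W (g • i) := fun v hv =>
    hmap g i ▸ Submodule.mem_map_of_mem hv
  have htrans : MulAction.IsPretransitive G (Fin m) := by
    refine ⟨fun i j => ?_⟩
    have hsup := hirr (⨆ g : G, W (g • i)) (by
      intro g v hv
      induction hv using Submodule.iSup_induction' with
      | mem h x hx =>
        exact Submodule.mem_iSup_of_mem (g * h) (mul_smul g h i ▸ hρ g _ x hx)
      | zero => simp
      | add x y _ _ hx hy =>
        rw [map_add]
        exact add_mem hx hy)
    have hi : W i ≤ ⨆ g : G, W (g • i) := by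
      simpa using le_iSup (fun g : G => W (g • i)) 1
    by_contra! hne
    have hle : (⨆ g : G, W (g • i)) ≤ ⨆ l ≠ j, W l :=
      iSup_le fun g => le_iSup₂_of_le (g • i) (hne g) le_rfl
    rw [hsup.resolve_left fun h => hWne i (le_bot_iff.1 (h ▸ hi))] at hle
    have hdisj := hWint.submodule_iSupIndep j
    rw [top_le_iff.1 hle, disjoint_top] at hdisj
    exact hWne j hdisj
  have hrank (i j : Fin m) : Module.finrank k (W i) = Module.finrank k (W j) := by
    obtain ⟨g, rfl⟩ := MulAction.exists_smul_eq G i j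
    have hginj : Function.Injective (ρ g) := (ρ.apply_bijective g).injective
    rw [← hmap g i]
    exact (Submodule.equivMapOfInjective (ρ g) hginj (W i)).finrank_eq
  have hmul (i : Fin m) : n = m * Module.finrank k (W i) := by
    rw [← hn, ← (LinearEquiv.ofBijective (DirectSum.coeLinearMap W) hWint).finrank_eq,
      Module.finrank_directSum, Finset.sum_congr rfl fun j _ => hrank j i]
    simp
  let i₀ : Fin m := ⟨0, by omega⟩
  have hindex : (MulAction.stabilizer G i₀).index = m := by
    rw [MulAction.index_stabilizer_of_transitive, Nat.card_fin]
  have hG' : G' ≤ MulAction.stabilizer G i₀ := by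
    intro g hg
    refine hWint.injective_of_ne_bot hWne ((hmap g i₀).symm.trans ?_)
    refine (hWirr i₀ _ ?_ ?_).resolve_left ?_
    · rintro _ ⟨v, hv, rfl⟩
      exact hWinv i₀ ⟨g, hg⟩ v hv
    · rw [hmap]
      exact hWinv _
    · rw [hmap]
      exact hWne _
  refine ⟨⟨_, hmul i₀⟩, fun i => ?_, MulAction.stabilizer G i₀, hG', ?_, hindex,
    ⟨W i₀, stabilizerRep ρ hρ i₀⟩, ?_, ?_, exists_equiv_indRep_stabilizer hρ hWint i₀⟩
  · rw [hmul i, Nat.mul_div_cancel_left _ (by omega)]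
  · intro h
    rw [h, Subgroup.index_top] at hindex
    omega
  · obtain ⟨w, hw, hw0⟩ := (W i₀).ne_bot_iff.1 (hWne i₀)
    exact ⟨⟨w, hw⟩, fun h => hw0 (congrArg Subtype.val h)⟩
  · intro q hq
    have hinj := Submodule.map_injective_of_injective (W i₀).injective_subtype
    rcases hWirr i₀ (q.map (W i₀).subtype) (Submodule.map_subtype_le _ _) (by
      rintro g _ ⟨w, hw, rfl⟩
      exact ⟨_, hq ⟨g, hG' g.2⟩ w hw, rfl⟩) with h | h
    · left
      exact hinj (h.trans (Submodule.map_bot _).symm)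
    · right
      exact hinj (h.trans (Submodule.map_subtype_top _).symm)
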